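/- Extension lemma, C¹ case: let I ⊆ ℝ be an open interval, let n ≤ N, and let μ_1, …, μ_N : I → ℂ and λ_1, …, λ_n : I → ℂ be C¹ functions such that for every t ∈ I and z ∈ ℂ the number of indices j ≤ n with λ_j(t) = z is at most the number of indices j ≤ N with μ_j(t) = z. Then there exist C¹ functions λ_{n+1}, …, λ_N : I → ℂ such that for every t ∈ I and z ∈ ℂ the number of indices j ≤ N with λ_j(t) = z equals the number of indices j ≤ N with μ_j(t) = z. -/

import Mathlib

namespace ExtLemma
open Set Filter Topology

/-- the multiset of values of a finite family -/
def ms {X : Type*} {n : ℕ} (f : Fin n → X) : Multiset X := Finset.univ.val.map f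

lemma ms_succAbove {X : Type*} {n : ℕ} (f : Fin (n + 1) → X) (k : Fin (n + 1)) :
    ms f = f k ::ₘ ms (fun i => f (k.succAbove i)) := by
  unfold ms
  rw [Fin.univ_succAbove n k]
  simp [Function.comp_def]

lemma ms_succ {X : Type*} {n : ℕ} (f : Fin (n + 1) → X) :
    ms f = f 0 ::ₘ ms (fun i : Fin n => f i.succ) := by
  simpa using ms_succAbove f 0

lemma mem_ms {X : Type*} {n : ℕ} (f : Fin n → X) (z : X) : z ∈ ms f ↔ ∃ i, f i = z := by
  simp [ms]

lemma count_ms {X : Type*} [DecidableEq X] {n : ℕ} (f : Fin n → X) (z : X) :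
    (ms f).count z = Nat.card {j : Fin n // f j = z} := by
  unfold ms
  rw [Multiset.count_map, Nat.card_eq_fintype_card, Fintype.card_subtype]
  simp only [eq_comm]
  rfl

lemma ms_map {X Y : Type*} {n : ℕ} (f : Fin n → X) (g : X → Y) :
    (ms f).map g = ms (fun i => g (f i)) := by
  simp [ms, Function.comp_def]

lemma ms_comp_perm {X : Type*} {n : ℕ} (f : Fin n → X) (σ : Equiv.Perm (Fin n)) :
    ms (fun i => f (σ i)) = ms f := by
  classical
  ext z
  rw [count_ms, count_ms]
  exact Nat.card_congr (σ.subtypeEquiv (fun _ => Iff.rfl))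

lemma exists_perm {X : Type*} {n : ℕ} (f g : Fin n → X) (h : ms f = ms g) :
    ∃ σ : Equiv.Perm (Fin n), ∀ i, g (σ i) = f i := by
  classical
  have h1 : ∀ z, Nonempty ({j // f j = z} ≃ {j // g j = z}) := fun z => by
    have := congrArg (Multiset.count z) h
    rw [count_ms, count_ms] at this
    exact Finite.card_eq.1 this
  let E := fun z => (h1 z).some
  refine ⟨(Equiv.sigmaFiberEquiv f).symm.trans
    ((Equiv.sigmaCongrRight E).trans (Equiv.sigmaFiberEquiv g)), fun i => ?_⟩
  exact (E (f i) ⟨i, rfl⟩).2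

/-- continuous selection of `M` on `S` -/
def Sol {X : Type*} [TopologicalSpace X] {n : ℕ} (M : ℝ → Multiset X) (ν : Fin n → ℝ → X)
    (S : Set ℝ) : Prop :=
  (∀ i, ContinuousOn (ν i) S) ∧ ∀ t ∈ S, ms (fun i => ν i t) = M t

lemma Sol.mono {X : Type*} [TopologicalSpace X] {n : ℕ} {M : ℝ → Multiset X}
    {ν : Fin n → ℝ → X} {S T : Set ℝ} (h : Sol M ν S) (hT : T ⊆ S) : Sol M ν T :=
  ⟨fun i => (h.1 i).mono hT, fun t ht => h.2 t (hT ht)⟩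

lemma glue {X : Type*} [TopologicalSpace X] {n : ℕ} {M : ℝ → Multiset X}
    {ν ν' : Fin n → ℝ → X} {A B : Set ℝ} (hA : IsClosed A) (hB : IsClosed B) {y : ℝ}
    (hAB : ∀ t ∈ A, t ∈ B → t = y) (hyA : y ∈ A) (hyB : y ∈ B)
    (h : Sol M ν A) (h' : Sol M ν' B) :
    ∃ ρ : Fin n → ℝ → X, Sol M ρ (A ∪ B) ∧ ∀ i, ∀ t ∈ A, ρ i t = ν i t := by
  classical
  obtain ⟨σ, hσ⟩ := exists_perm (fun i => ν i y) (fun i => ν' i y)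
    ((h.2 y hyA).trans (h'.2 y hyB).symm)
  let ρ : Fin n → ℝ → X := fun i t => if t ∈ A then ν i t else ν' (σ i) t
  have h1 : ∀ i, ∀ t ∈ A, ρ i t = ν i t := fun i t ht => by simp [ρ, ht]
  have h2 : ∀ i, ∀ t ∈ B, ρ i t = ν' (σ i) t := fun i t ht => by
    by_cases htA : t ∈ A
    · rw [h1 i t htA, hAB t htA ht]; exact (hσ i).symm
    · simp [ρ, htA]
  refine ⟨ρ, ⟨fun i => ?_, ?_⟩, h1⟩
  · exact ((h.1 i).congr (h1 i)).union_of_isClosed ((h'.1 (σ i)).congr (h2 i)) hA hB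
  · rintro t (ht | ht)
    · rw [← h.2 t ht]; congr 1; funext i; exact h1 i t ht
    · rw [← h'.2 t ht, ← ms_comp_perm (fun i => ν' i t) σ]; congr 1; funext i; exact h2 i t ht

lemma sol_uIcc {X : Type*} [TopologicalSpace X] {n : ℕ} {M : ℝ → Multiset X} {U : Set ℝ}
    (hc : U.OrdConnected)
    (hloc : ∀ t ∈ U, ∃ W ∈ 𝓝 t, ∃ ν : Fin n → ℝ → X, Sol M ν W) :
    ∀ s ∈ U, ∀ t ∈ U, ∃ ν : Fin n → ℝ → X, Sol M ν (uIcc s t) := by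
  intro s hs t ht
  refine hc.isPreconnected.induction₂ (fun s t => ∃ ν : Fin n → ℝ → X, Sol M ν (uIcc s t))
    ?_ ?_ ?_ hs ht
  · intro x hx
    obtain ⟨W, hW, ν, hν⟩ := hloc x hx
    obtain ⟨ε, hε, hb⟩ := Metric.mem_nhds_iff.1 hW
    filter_upwards [mem_nhdsWithin_of_mem_nhds (Metric.ball_mem_nhds x hε)] with y hy
    refine ⟨ν, hν.mono (Subset.trans ?_ hb)⟩
    have : (Metric.ball x ε).OrdConnected := (convex_ball x ε).ordConnected
    exact this.uIcc_subset (Metric.mem_ball_self hε) hy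
  · rintro x y z - - - ⟨ν, hν⟩ ⟨ν', hν'⟩
    by_cases hy : y ∈ uIcc x z
    · obtain ⟨ρ, hρ, -⟩ := glue (A := uIcc x y) (B := uIcc y z) (y := y) isClosed_Icc isClosed_Icc
        (by
          intro t h1 h2
          rw [mem_uIcc] at *
          grind) right_mem_uIcc left_mem_uIcc hν hν'
      exact ⟨ρ, hρ.mono uIcc_subset_uIcc_union_uIcc⟩
    · by_cases hz : z ∈ uIcc x y
      · exact ⟨ν, hν.mono (uIcc_subset_uIcc_left hz)⟩
      · refine ⟨ν', hν'.mono (uIcc_subset_uIcc_right ?_)⟩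
        rw [mem_uIcc] at *
        grind
  · rintro x y - - ⟨ν, hν⟩
    exact ⟨ν, by rwa [uIcc_comm]⟩

lemma extend_step {X : Type*} [TopologicalSpace X] {n : ℕ} {M : ℝ → Multiset X} {U : Set ℝ}
    (H : ∀ s ∈ U, ∀ t ∈ U, ∃ ν : Fin n → ℝ → X, Sol M ν (uIcc s t))
    (a b e : ℝ) (ha : a ∈ U) (hb : b ∈ U) (he : e ∈ U) (hab : a ≤ b) (ν : Fin n → ℝ → X)
    (hν : Sol M ν (Icc a b)) :
    ∃ ρ : Fin n → ℝ → X, Sol M ρ (Icc (min a e) (max b e)) ∧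
      ∀ i, ∀ t ∈ Icc a b, ρ i t = ν i t := by
  rcases lt_or_ge e a with h | h
  · obtain ⟨ν', hν'⟩ := H e he a ha
    rw [uIcc_of_le h.le] at hν'
    obtain ⟨ρ, hρ, h2⟩ := glue (y := a) isClosed_Icc isClosed_Icc
        (by rintro t ⟨h1, h2⟩ ⟨h3, h4⟩; linarith) (left_mem_Icc.2 hab) (right_mem_Icc.2 h.le) hν hν'
    refine ⟨ρ, hρ.mono ?_, h2⟩
    rw [min_eq_right h.le, max_eq_left (by linarith), union_comm, Icc_union_Icc_eq_Icc h.le hab]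
  · rcases le_or_gt e b with h' | h'
    · exact ⟨ν, by rwa [min_eq_left h, max_eq_left h'], fun _ _ _ => rfl⟩
    · obtain ⟨ν', hν'⟩ := H b hb e he
      rw [uIcc_of_le h'.le] at hν'
      obtain ⟨ρ, hρ, h2⟩ := glue (y := b) isClosed_Icc isClosed_Icc
        (by rintro t ⟨h1, h2⟩ ⟨h3, h4⟩; linarith) (right_mem_Icc.2 hab) (left_mem_Icc.2 h'.le) hν hν'
      refine ⟨ρ, hρ.mono ?_, h2⟩
      rw [min_eq_left h, max_eq_right h'.le, Icc_union_Icc_eq_Icc hab h'.le]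

lemma sol_global {X : Type*} [TopologicalSpace X] {n : ℕ} {M : ℝ → Multiset X} {U : Set ℝ}
    (hU : IsOpen U) (hc : U.OrdConnected) (hne : U.Nonempty)
    (hloc : ∀ t ∈ U, ∃ W ∈ 𝓝 t, ∃ ν : Fin n → ℝ → X, Sol M ν W) :
    ∃ ν : Fin n → ℝ → X, Sol M ν U := by
  classical
  have H := sol_uIcc hc hloc
  have : Nonempty U := hne.to_subtype
  let e : ℕ → U := TopologicalSpace.denseSeq U
  have he : DenseRange e := TopologicalSpace.denseRange_denseSeq U
  have hex : ∀ W : Set ℝ, IsOpen W → (W ∩ U).Nonempty → ∃ k, (e k : ℝ) ∈ W := by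
    rintro W hW ⟨w, hw, hwU⟩
    exact he.exists_mem_open (hW.preimage continuous_subtype_val) ⟨⟨w, hwU⟩, hw⟩
  let State := {p : ℝ × ℝ × (Fin n → ℝ → X) //
    p.1 ∈ U ∧ p.2.1 ∈ U ∧ p.1 ≤ p.2.1 ∧ Sol M p.2.2 (Icc p.1 p.2.1)}
  have hstep : ∀ (k : ℕ) (p : State), ∃ q : State, q.1.1 = min p.1.1 (e k) ∧
      q.1.2.1 = max p.1.2.1 (e k) ∧
      ∀ i, ∀ t ∈ Icc p.1.1 p.1.2.1, q.1.2.2 i t = p.1.2.2 i t := by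
    rintro k ⟨⟨a, b, ν⟩, ha, hb, hab, hν⟩
    obtain ⟨ρ, hρ, h2⟩ := extend_step H a b (e k) ha hb (e k).2 hab ν hν
    refine ⟨⟨⟨min a (e k), max b (e k), ρ⟩, ?_, ?_, ?_, hρ⟩, rfl, rfl, h2⟩
    · rcases min_choice a (e k : ℝ) with h | h <;> simp only [h]
      exacts [ha, (e k).2]
    · rcases max_choice b (e k : ℝ) with h | h <;> simp only [h]
      exacts [hb, (e k).2]
    · exact (min_le_left _ _).trans (hab.trans (le_max_left _ _))
  choose step h1 h2 h3 using hstep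
  obtain ⟨t0, ht0⟩ := hne
  obtain ⟨ν0, hν0⟩ := H t0 ht0 t0 ht0
  let p0 : State := ⟨⟨t0, t0, ν0⟩, ht0, ht0, le_rfl, by simpa using hν0⟩
  let s : ℕ → State := fun k => Nat.rec p0 (fun k p => step k p) k
  have hs : ∀ k, s (k + 1) = step k (s k) := fun k => rfl
  have ha : Antitone (fun k => (s k).1.1) := antitone_nat_of_succ_le fun k => by
    rw [hs, h1]; exact min_le_left _ _
  have hb : Monotone (fun k => (s k).1.2.1) := monotone_nat_of_le_succ fun k => by
    rw [hs, h2]; exact le_max_left _ _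
  have hagree : ∀ k m, k ≤ m → ∀ i, ∀ t ∈ Icc (s k).1.1 (s k).1.2.1,
      (s m).1.2.2 i t = (s k).1.2.2 i t := by
    intro k m hkm i t ht
    induction m, hkm using Nat.le_induction with
    | base => rfl
    | succ m hm ih =>
      rw [← ih, hs]
      exact h3 m (s m) i t ⟨(ha hm).trans ht.1, ht.2.trans (hb hm)⟩
  have hcov : ∀ t ∈ U, ∃ k, t ∈ Ioo (s k).1.1 (s k).1.2.1 := by
    intro t ht
    obtain ⟨ε, hε, hball⟩ := Metric.isOpen_iff.1 hU t ht
    obtain ⟨k, hk⟩ := hex (Iio t) isOpen_Iio ⟨t - ε / 2, by simp [hε], hball (by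
      simp [Real.dist_eq, abs_of_pos hε, hε])⟩
    obtain ⟨m, hm⟩ := hex (Ioi t) isOpen_Ioi ⟨t + ε / 2, by simp [hε], hball (by
      simp [Real.dist_eq, abs_of_pos hε, hε])⟩
    refine ⟨max (k + 1) (m + 1), ?_, ?_⟩
    · refine (ha (le_max_left _ _)).trans_lt ?_
      simp only [hs, h1]
      exact (min_le_right _ _).trans_lt hk
    · refine lt_of_lt_of_le ?_ (hb (le_max_right _ _))
      simp only [hs, h2]
      exact lt_of_lt_of_le hm (le_max_right _ _)
  choose! K hK using hcov
  let ν : Fin n → ℝ → X := fun i t => (s (K t)).1.2.2 i t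
  have hν : ∀ k i, ∀ t ∈ U, t ∈ Icc (s k).1.1 (s k).1.2.1 → ν i t = (s k).1.2.2 i t := by
    intro k i t ht htk
    rw [← hagree k _ (le_max_left k (K t)) i t htk,
      hagree (K t) _ (le_max_right k (K t)) i t (Ioo_subset_Icc_self (hK t ht))]
  refine ⟨ν, fun i t ht => ?_, fun t ht => ?_⟩
  · have hn : Ioo (s (K t)).1.1 (s (K t)).1.2.1 ∈ 𝓝 t := Ioo_mem_nhds (hK t ht).1 (hK t ht).2
    have hc1 : ContinuousAt ((s (K t)).1.2.2 i) t :=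
      ((s (K t)).2.2.2.2.1 i).continuousAt (mem_of_superset hn Ioo_subset_Icc_self)
    refine (hc1.congr ?_).continuousWithinAt
    filter_upwards [hn, hU.mem_nhds ht] with x hx hxU
    exact (hν _ i x hxU (Ioo_subset_Icc_self hx)).symm
  · exact (s (K t)).2.2.2.2.2 t (Ioo_subset_Icc_self (hK t ht))

lemma removal {X : Type*} [NormedAddCommGroup X] (N : ℕ) : ∀ (I : Set ℝ) (_ : IsOpen I)
    (f : Fin (N + 1) → ℝ → X)
    (_ : ∀ j, ContinuousOn (f j) I) (_ : ∀ t ∈ I, ∃ j, f j t = 0),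
    ∃ ν : Fin N → ℝ → X, (∀ i, ContinuousOn (ν i) I) ∧
      ∀ t ∈ I, (0 : X) ::ₘ ms (fun i => ν i t) = ms (fun j => f j t) := by
  classical
  induction N with
  | zero =>
    intro I hI f hf h0
    refine ⟨fun i => i.elim0, fun i => i.elim0, fun t ht => ?_⟩
    obtain ⟨j, hj⟩ := h0 t ht
    obtain rfl : j = 0 := Subsingleton.elim (α := Fin 1) _ _
    rw [ms_succ, hj]; rfl
  | succ N ih =>
    intro I hI f hf h0
    let M : ℝ → Multiset X := fun t => (ms (fun j => f j t)).erase 0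
    have hM : ∀ t ∈ I, (0 : X) ::ₘ M t = ms (fun j => f j t) := fun t ht =>
      Multiset.cons_erase ((mem_ms _ _).2 (h0 t ht))
    let V : Set ℝ := {t | t ∈ I ∧ ∃ k, f k t ≠ 0}
    have hnear : ∀ t ∈ I, ∀ k, f k t ≠ 0 → ∃ W ∈ 𝓝 t, IsOpen W ∧ W ⊆ I ∧ ∀ x ∈ W, f k x ≠ 0 := by
      intro t ht k hk
      have h1 : ∀ᶠ x in 𝓝 t, x ∈ I ∧ f k x ≠ 0 :=
        Filter.Eventually.and (hI.mem_nhds ht) (((hf k).continuousAt (hI.mem_nhds ht)).eventually_ne hk)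
      obtain ⟨W, hW, hWo, htW⟩ := eventually_nhds_iff.1 h1
      exact ⟨W, hWo.mem_nhds htW, hWo, fun x hx => (hW x hx).1, fun x hx => (hW x hx).2⟩
    have hV : IsOpen V := by
      rw [isOpen_iff_mem_nhds]
      rintro t ⟨ht, k, hk⟩
      obtain ⟨W, hW, -, hWI, hWk⟩ := hnear t ht k hk
      exact mem_of_superset hW fun x hx => ⟨hWI hx, k, hWk x hx⟩
    have hloc : ∀ t ∈ V, ∃ W ∈ 𝓝 t, ∃ ν : Fin (N + 1) → ℝ → X, Sol M ν W := by
      rintro t ⟨ht, k, hk⟩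
      obtain ⟨W, hW, hWo, hWI, hWk⟩ := hnear t ht k hk
      obtain ⟨ν, hν, hν2⟩ := ih W hWo (fun i => f (k.succAbove i))
        (fun i => (hf _).mono hWI) (fun x hx => by
          obtain ⟨j, hj⟩ := h0 x (hWI hx)
          have hjk : j ≠ k := fun h => hWk x hx (h ▸ hj)
          obtain ⟨i, rfl⟩ := Fin.exists_succAbove_eq hjk
          exact ⟨i, hj⟩)
      refine ⟨W, hW, Fin.cons (f k) ν, fun i => ?_, fun x hx => ?_⟩
      · refine Fin.cases ?_ (fun i => ?_) i
        · simpa using (hf k).mono hWI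
        · simpa using hν i
      · have h1 := hM x (hWI hx)
        rw [ms_succAbove _ k, ← hν2 x hx, Multiset.cons_swap] at h1
        rw [(Multiset.cons_inj_right _).1 h1, ms_succ]
        simp
    have hcomp : ∀ C : Set ℝ, ∃ ν : Fin (N + 1) → ℝ → X,
        ∀ t ∈ V, connectedComponentIn V t = C → Sol M ν C := by
      intro C
      by_cases h : ∃ t ∈ V, connectedComponentIn V t = C
      · obtain ⟨t, ht, rfl⟩ := h
        obtain ⟨ν, hν⟩ := sol_global (M := M) (n := N + 1) (hV.connectedComponentIn (x := t))
          isPreconnected_connectedComponentIn.ordConnected ⟨t, mem_connectedComponentIn ht⟩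
          (fun x hx => hloc x (connectedComponentIn_subset _ _ hx))
        exact ⟨ν, fun _ _ _ => hν⟩
      · exact ⟨fun _ _ => 0, fun t ht hC => (h ⟨t, ht, hC⟩).elim⟩
    choose F hF using hcomp
    let ν : Fin (N + 1) → ℝ → X := fun i t =>
      if t ∈ V then F (connectedComponentIn V t) i t else 0
    have hms : ∀ t ∈ I, (0 : X) ::ₘ ms (fun i => ν i t) = ms (fun j => f j t) := by
      intro t ht
      by_cases htV : t ∈ V
      · simp only [ν, htV, if_true]
        rw [(hF _ t htV rfl).2 t (mem_connectedComponentIn htV)]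
        exact hM t ht
      · have hz : ∀ k, f k t = 0 := by
          intro k; by_contra hk; exact htV ⟨ht, k, hk⟩
        simp only [ν, htV, if_false, hz]
        exact (ms_succ (fun _ : Fin (N + 1 + 1) => (0 : X))).symm
    refine ⟨ν, fun i t ht => ?_, hms⟩
    by_cases htV : t ∈ V
    · have hn : connectedComponentIn V t ∈ 𝓝 t :=
        hV.connectedComponentIn.mem_nhds (mem_connectedComponentIn htV)
      have hc1 : ContinuousAt (F (connectedComponentIn V t) i) t :=
        ((hF _ t htV rfl).1 i).continuousAt hn
      refine (hc1.congr ?_).continuousWithinAt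
      filter_upwards [hn] with x hx
      simp only [ν, connectedComponentIn_subset _ _ hx, if_true]
      rw [connectedComponentIn_eq hx]
    · have hz : ∀ k, f k t = 0 := by
        intro k; by_contra hk; exact htV ⟨ht, k, hk⟩
      have hνt : ν i t = 0 := by simp [ν, htV]
      refine ContinuousAt.continuousWithinAt ?_
      rw [ContinuousAt, hνt, Metric.tendsto_nhds]
      intro ε hε
      have h1 : ∀ᶠ x in 𝓝 t, ∀ k, dist (f k x) 0 < ε := eventually_all.2 fun k => by
        have := ((hf k).continuousAt (hI.mem_nhds ht)).tendsto
        rw [hz k] at this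
        exact Metric.tendsto_nhds.1 this ε hε
      filter_upwards [h1, hI.mem_nhds ht] with x hx hxI
      have hm : ν i x ∈ ms (fun j => f j x) := by
        rw [← hms x hxI]
        exact Multiset.mem_cons_of_mem ((mem_ms _ _).2 ⟨i, rfl⟩)
      obtain ⟨j, hj⟩ := (mem_ms _ _).1 hm
      rw [← hj]; exact hx j

lemma removalC1 (N : ℕ) (I : Set ℝ) (hI : IsOpen I) (μ : Fin (N + 1) → ℝ → ℂ) (l : ℝ → ℂ)
    (hμ : ∀ j, ContDiffOn ℝ 1 (μ j) I) (hl : ContDiffOn ℝ 1 l I)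
    (h : ∀ t ∈ I, ∃ j, μ j t = l t) :
    ∃ ν : Fin N → ℝ → ℂ, (∀ i, ContDiffOn ℝ 1 (ν i) I) ∧
      ∀ t ∈ I, l t ::ₘ ms (fun i => ν i t) = ms (fun j => μ j t) := by
  let g : Fin (N + 1) → ℝ → ℂ := fun j t => μ j t - l t
  have hg : ∀ j, ContDiffOn ℝ 1 (g j) I := fun j => (hμ j).sub hl
  have hgd : ∀ j, ∀ t ∈ I, HasDerivAt (g j) (deriv (g j) t) t := fun j t ht =>
    (((hg j).differentiableOn one_ne_zero).differentiableAt (hI.mem_nhds ht)).hasDerivAt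
  have hgc : ∀ j, ContinuousOn (deriv (g j)) I := fun j =>
    (hg j).continuousOn_deriv_of_isOpen hI le_rfl
  let f : Fin (N + 1) → ℝ → ℂ × ℂ := fun j t => (g j t, deriv (g j) t)
  have hf : ∀ j, ContinuousOn (f j) I := fun j => (hg j).continuousOn.prodMk (hgc j)
  have h0 : ∀ t ∈ I, ∃ j, f j t = 0 := by
    intro t ht
    by_contra! hcon
    have h1 : ∀ᶠ x in 𝓝[≠] t, ∀ j, g j x ≠ 0 := eventually_all.2 fun j => by
      by_cases hd : deriv (g j) t = 0
      · have : g j t ≠ 0 := fun h' => hcon j (Prod.ext h' hd)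
        exact ((hgd j t ht).continuousAt.eventually_ne this).filter_mono nhdsWithin_le_nhds
      · exact (hgd j t ht).eventually_ne hd
    have h2 : ∀ᶠ x in 𝓝[≠] t, x ∈ I := mem_nhdsWithin_of_mem_nhds (hI.mem_nhds ht)
    obtain ⟨x, hx1, hx2⟩ := (h1.and h2).exists
    obtain ⟨j, hj⟩ := h x hx2
    exact hx1 j (sub_eq_zero.2 hj)
  obtain ⟨ν, hνc, hν⟩ := removal N I hI f hf h0
  have hder : ∀ i, ∀ t ∈ I, HasDerivAt (fun x => (ν i x).1) (ν i t).2 t := by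
    intro i t ht
    rw [hasDerivAt_iff_isLittleO, Asymptotics.isLittleO_iff]
    intro c hc
    have h1 : ∀ᶠ x in 𝓝 t, ∀ j, f j x = ν i x →
        ‖(ν i x).1 - (ν i t).1 - (x - t) • (ν i t).2‖ ≤ c * ‖x - t‖ := eventually_all.2 fun j => by
      by_cases hj : f j t = ν i t
      · have h2 := hgd j t ht
        rw [hasDerivAt_iff_isLittleO, Asymptotics.isLittleO_iff] at h2
        filter_upwards [h2 hc] with x hx hxe
        rw [← hxe, ← hj]
        exact hx
      · have h3 := (((hf j).continuousAt (hI.mem_nhds ht)).prodMk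
          ((hνc i).continuousAt (hI.mem_nhds ht))).eventually_mem
          (isOpen_ne_fun continuous_fst continuous_snd |>.mem_nhds hj)
        filter_upwards [h3] with x hx hxe
        exact (hx hxe).elim
    filter_upwards [h1, hI.mem_nhds ht] with x hx hxI
    have hm : ν i x ∈ ms (fun j => f j x) := by
      rw [← hν x hxI]
      exact Multiset.mem_cons_of_mem ((mem_ms _ _).2 ⟨i, rfl⟩)
    obtain ⟨j, hj⟩ := (mem_ms _ _).1 hm
    exact hx j hj
  refine ⟨fun i t => (ν i t).1 + l t, fun i => ContDiffOn.add ?_ hl, fun t ht => ?_⟩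
  · rw [show (1 : WithTop ℕ∞) = 0 + 1 by simp, contDiffOn_succ_iff_deriv_of_isOpen hI]
    refine ⟨fun t ht => (hder i t ht).differentiableAt.differentiableWithinAt, by simp, ?_⟩
    rw [contDiffOn_zero]
    exact (continuous_snd.comp_continuousOn (hνc i)).congr fun t ht => (hder i t ht).deriv
  · have := congrArg (Multiset.map (fun p : ℂ × ℂ => p.1 + l t)) (hν t ht)
    rw [Multiset.map_cons, ms_map, ms_map] at this
    simpa [f, g] using this

lemma extend_all (I : Set ℝ) (hI : IsOpen I) (m n : ℕ) : ∀ (N : ℕ) (_ : N = m + n)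
    (μ : Fin N → ℝ → ℂ) (l : Fin n → ℝ → ℂ)
    (_ : ∀ j, ContDiffOn ℝ 1 (μ j) I) (_ : ∀ j, ContDiffOn ℝ 1 (l j) I)
    (_ : ∀ t ∈ I, ms (fun j => l j t) ≤ ms (fun j => μ j t)),
    ∃ ρ : Fin m → ℝ → ℂ, (∀ i, ContDiffOn ℝ 1 (ρ i) I) ∧
      ∀ t ∈ I, ms (fun j => l j t) + ms (fun i => ρ i t) = ms (fun j => μ j t) := by
  induction n with
  | zero =>
    rintro N rfl μ l hμ hl h
    refine ⟨μ, hμ, fun t ht => ?_⟩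
    simp [ms]
  | succ n ih =>
    rintro N rfl μ l hμ hl h
    obtain ⟨ν, hν, hν2⟩ := removalC1 (m + n) I hI μ (l 0) hμ (hl 0) (fun t ht => by
      have := Multiset.mem_of_le (h t ht) ((mem_ms _ _).2 ⟨0, rfl⟩)
      exact (mem_ms _ _).1 this)
    obtain ⟨ρ, hρ, hρ2⟩ := ih (m + n) rfl ν (fun i => l i.succ) hν (fun i => hl _)
      (fun t ht => by
        have := h t ht
        rw [ms_succ] at this
        exact (Multiset.cons_le_cons_iff _).1 (this.trans_eq (hν2 t ht).symm))
    refine ⟨ρ, hρ, fun t ht => ?_⟩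
    rw [ms_succ, Multiset.cons_add, hρ2 t ht]
    exact hν2 t ht

lemma ms_append {X : Type*} {n m : ℕ} (a : Fin n → X) (b : Fin m → X) :
    ms (Fin.append a b) = ms a + ms b := by
  classical
  ext z
  rw [Multiset.count_add, count_ms, count_ms, count_ms, ← Nat.card_sum]
  refine (Nat.card_congr ?_).symm
  let e1 : {s : Fin n ⊕ Fin m // Fin.append a b (finSumFinEquiv s) = z} ≃
      {j // Fin.append a b j = z} := finSumFinEquiv.subtypeEquiv (fun _ => Iff.rfl)
  refine Equiv.trans ?_ (Equiv.subtypeSum.symm.trans e1)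
  exact Equiv.sumCongr (Equiv.subtypeEquivRight fun i => by simp)
    (Equiv.subtypeEquivRight fun i => by simp)

end ExtLemma

theorem extension_lemma_C1 (N n : ℕ) (hn : n ≤ N)
    (I : Set ℝ) (hIopen : IsOpen I) (hI : I.OrdConnected)
    (μ : Fin N → ℝ → ℂ) (l : Fin n → ℝ → ℂ)
    (hμ : ∀ j, ContDiffOn ℝ 1 (μ j) I) (hl : ∀ j, ContDiffOn ℝ 1 (l j) I)
    (hcard : ∀ t ∈ I, ∀ z : ℂ,
      Nat.card {j : Fin n // l j t = z} ≤ Nat.card {j : Fin N // μ j t = z}) :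
    ∃ L : Fin N → ℝ → ℂ,
      (∀ j, ContDiffOn ℝ 1 (L j) I) ∧
      (∀ j : Fin n, ∀ t ∈ I, L (Fin.castLE hn j) t = l j t) ∧
      (∀ t ∈ I, ∀ z : ℂ,
        Nat.card {j : Fin N // L j t = z} = Nat.card {j : Fin N // μ j t = z}) := by
  classical
  obtain ⟨m, rfl⟩ := Nat.exists_eq_add_of_le hn
  obtain ⟨ρ, hρ, hρ2⟩ := ExtLemma.extend_all I hIopen m n (n + m) (Nat.add_comm n m) μ l hμ hl
    (fun t ht => Multiset.le_iff_count.2 fun z => by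
      rw [ExtLemma.count_ms, ExtLemma.count_ms]; exact hcard t ht z)
  refine ⟨Fin.append l ρ, fun j => ?_, fun j t ht => ?_, fun t ht z => ?_⟩
  · refine Fin.addCases (fun i => ?_) (fun i => ?_) j
    · simpa using hl i
    · simpa using hρ i
  · exact congrFun (Fin.append_left l ρ j) t
  · rw [← ExtLemma.count_ms, ← ExtLemma.count_ms, ← hρ2 t ht, ← ExtLemma.ms_append]
    congr 2
    funext j
    refine Fin.addCases (fun i => ?_) (fun i => ?_) j <;> simp
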